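/- Let (X, Δ, ε) be a cocommutative coalgebra over a commutative ring k and let T : X⊗X⊗X → X be a ternary self-distributive coalgebra morphism. Define β : X^{⊗4} → X^{⊗4} by β(x⊗x'⊗y⊗z) = y⁽¹⁾ ⊗ z⁽¹⁾ ⊗ T(x⊗y⁽²⁾⊗z⁽²⁾) ⊗ T(x'⊗y⁽³⁾⊗z⁽³⁾). Then β satisfies the Yang–Baxter equation on X^{⊗6}: (β ⊗ id_{X⊗X}) ∘ (id_{X⊗X} ⊗ β) ∘ (β ⊗ id_{X⊗X}) = (id_{X⊗X} ⊗ β) ∘ (β ⊗ id_{X⊗X}) ∘ (id_{X⊗X} ⊗ β). -/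

import Mathlib

open TensorProduct

/-- The finite family `(x1 i) ⊗ (x2 i)` represents the comultiplication of `x`. -/
def Rep2 (k : Type*) {X : Type*} [CommRing k] [AddCommMonoid X] [Module k X] [Coalgebra k X]
    (x : X) {n : ℕ} (x1 x2 : Fin n → X) : Prop :=
  Coalgebra.comul (R := k) x = ∑ i, x1 i ⊗ₜ[k] x2 i

/-- The twofold iterated comultiplication `x ↦ x⁽¹⁾ ⊗ (x⁽²⁾ ⊗ x⁽³⁾)`. -/
noncomputable def delta3 (k : Type*) {X : Type*} [CommRing k] [AddCommMonoid X] [Module k X]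
    [Coalgebra k X] : X →ₗ[k] X ⊗[k] (X ⊗[k] X) :=
  (LinearMap.lTensor X (Coalgebra.comul (R := k))) ∘ₗ Coalgebra.comul

/-- The finite family `(x1 i) ⊗ (x2 i) ⊗ (x3 i)` represents the iterated comultiplication
`x⁽¹⁾ ⊗ x⁽²⁾ ⊗ x⁽³⁾` of `x`. -/
def Rep3 (k : Type*) {X : Type*} [CommRing k] [AddCommMonoid X] [Module k X] [Coalgebra k X]
    (x : X) {n : ℕ} (x1 x2 x3 : Fin n → X) : Prop :=
  delta3 k x = ∑ i, x1 i ⊗ₜ[k] (x2 i ⊗ₜ[k] x3 i)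

/-- `T` is ternary self-distributive. -/
def IsTSD (k : Type*) {X : Type*} [CommRing k] [AddCommMonoid X] [Module k X] [Coalgebra k X]
    (T : X ⊗[k] (X ⊗[k] X) →ₗ[k] X) : Prop :=
  ∀ (x y z u v : X) {n m : ℕ} (u1 u2 u3 : Fin n → X) (v1 v2 v3 : Fin m → X),
    Rep3 k u u1 u2 u3 → Rep3 k v v1 v2 v3 →
    T (T (x ⊗ₜ[k] (y ⊗ₜ[k] z)) ⊗ₜ[k] (u ⊗ₜ[k] v)) =
      ∑ i, ∑ j, T (T (x ⊗ₜ[k] (u1 i ⊗ₜ[k] v1 j)) ⊗ₜ[k]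
        (T (y ⊗ₜ[k] (u2 i ⊗ₜ[k] v2 j)) ⊗ₜ[k] T (z ⊗ₜ[k] (u3 i ⊗ₜ[k] v3 j))))

/-- `T` is a coalgebra morphism. -/
def IsCoalgMor (k : Type*) {X : Type*} [CommRing k] [AddCommMonoid X] [Module k X]
    [Coalgebra k X] (T : X ⊗[k] (X ⊗[k] X) →ₗ[k] X) : Prop :=
  (∀ x y z : X, Coalgebra.counit (R := k) (T (x ⊗ₜ[k] (y ⊗ₜ[k] z))) =
      Coalgebra.counit (R := k) x * Coalgebra.counit (R := k) y * Coalgebra.counit (R := k) z) ∧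
  (∀ (x y z : X) {n₁ n₂ n₃ : ℕ} (x1 x2 : Fin n₁ → X) (y1 y2 : Fin n₂ → X) (z1 z2 : Fin n₃ → X),
    Rep2 k x x1 x2 → Rep2 k y y1 y2 → Rep2 k z z1 z2 →
    Coalgebra.comul (R := k) (T (x ⊗ₜ[k] (y ⊗ₜ[k] z))) =
      ∑ i, ∑ j, ∑ l, T (x1 i ⊗ₜ[k] (y1 j ⊗ₜ[k] z1 l)) ⊗ₜ[k] T (x2 i ⊗ₜ[k] (y2 j ⊗ₜ[k] z2 l)))

/-- `β ⊗ id` acting on the first two factors of `V ⊗ (V ⊗ V)`. -/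
noncomputable def beta12 {k V : Type*} [CommRing k] [AddCommGroup V] [Module k V]
    (β : V ⊗[k] V →ₗ[k] V ⊗[k] V) : V ⊗[k] (V ⊗[k] V) →ₗ[k] V ⊗[k] (V ⊗[k] V) :=
  (TensorProduct.assoc k V V V).toLinearMap ∘ₗ (TensorProduct.map β LinearMap.id) ∘ₗ
    (TensorProduct.assoc k V V V).symm.toLinearMap

/-- `id ⊗ β` acting on the last two factors of `V ⊗ (V ⊗ V)`. -/
noncomputable def beta23 {k V : Type*} [CommRing k] [AddCommGroup V] [Module k V]
    (β : V ⊗[k] V →ₗ[k] V ⊗[k] V) : V ⊗[k] (V ⊗[k] V) →ₗ[k] V ⊗[k] (V ⊗[k] V) :=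
  LinearMap.lTensor V β

theorem sum_comm_reverse {ι κ μ M : Type*} [AddCommMonoid M] (s : Finset ι) (t : Finset κ)
    (u : Finset μ) (f : ι → κ → μ → M) :
    ∑ i ∈ s, ∑ j ∈ t, ∑ l ∈ u, f i j l = ∑ l ∈ u, ∑ j ∈ t, ∑ i ∈ s, f i j l :=
  Finset.sum_comm_cycle.trans (Finset.sum_congr rfl fun _ _ => Finset.sum_comm)

/-- Every comultiplication can be written as a finite sum of pure tensors. -/
theorem exists_comul_eq_sum (k C : Type*) [CommRing k] [AddCommGroup C] [Module k C]
    [Coalgebra k C] :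
    ∃ S : C → Finset (C × C), ∀ c : C, Coalgebra.comul (R := k) c = ∑ p ∈ S c, p.1 ⊗ₜ[k] p.2 := by
  choose S hS using fun c : C => TensorProduct.exists_finset (R := k) (Coalgebra.comul (R := k) c)
  exact ⟨S, hS⟩

/-- In a cocommutative coalgebra the two middle legs of the fourfold comultiplication can be
interchanged. -/
theorem tensorTensorTensorComm_map_comul_comul (k : Type*) {C : Type*} [CommRing k]
    [AddCommGroup C] [Module k C] [Coalgebra k C] [Coalgebra.IsCocomm k C] (c : C) :
    TensorProduct.tensorTensorTensorComm k C C C C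
        (TensorProduct.map Coalgebra.comul Coalgebra.comul (Coalgebra.comul (R := k) c)) =
      TensorProduct.map Coalgebra.comul Coalgebra.comul (Coalgebra.comul (R := k) c) :=
  (LinearMap.congr_fun (Coalgebra.comulCoalgHom k C).map_comp_comul c).symm

section SelfDistributive

variable {k V : Type*} [CommRing k] [AddCommGroup V] [Module k V]

/-- The linear map `(p ⊗ r) ⊗ (s ⊗ t) ↦ p ⊗ (q(b ⊗ r) ⊗ q(q(a ⊗ s) ⊗ q(b' ⊗ t)))`. -/
noncomputable def braidWord (q : V ⊗[k] V →ₗ[k] V) (a b b' : V) :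
    (V ⊗[k] V) ⊗[k] (V ⊗[k] V) →ₗ[k] V ⊗[k] (V ⊗[k] V) :=
  (TensorProduct.assoc k V V V).toLinearMap ∘ₗ
    TensorProduct.map (LinearMap.lTensor V (q ∘ₗ TensorProduct.mk k V V b))
      (q ∘ₗ TensorProduct.map (q ∘ₗ TensorProduct.mk k V V a) (q ∘ₗ TensorProduct.mk k V V b'))

theorem braidWord_tmul (q : V ⊗[k] V →ₗ[k] V) (a b b' p r s t : V) :
    braidWord q a b b' ((p ⊗ₜ r) ⊗ₜ (s ⊗ₜ t)) =
      p ⊗ₜ[k] (q (b ⊗ₜ r) ⊗ₜ[k] q (q (a ⊗ₜ s) ⊗ₜ q (b' ⊗ₜ t))) := by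
  simp [braidWord]

variable [Coalgebra k V]

/-- The map `v ⊗ w ↦ w⁽¹⁾ ⊗ q(v ⊗ w⁽²⁾)`. -/
noncomputable def binaryBraiding (q : V ⊗[k] V →ₗ[k] V) : V ⊗[k] V →ₗ[k] V ⊗[k] V :=
  LinearMap.lTensor V q ∘ₗ (TensorProduct.leftComm k V V V).toLinearMap ∘ₗ
    LinearMap.lTensor V Coalgebra.comul

/-- A binary self-distributive coalgebra morphism on a cocommutative coalgebra induces a solution
of the Yang–Baxter equation. -/
theorem binaryBraiding_YBE [Coalgebra.IsCocomm k V] (q : V ⊗[k] V →ₗ[k] V)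
    (hq : ∀ v : V ⊗[k] V, Coalgebra.comul (R := k) (q v) =
      TensorProduct.map q q (Coalgebra.comul (R := k) v))
    (hsd : ∀ v w u : V, q (q (v ⊗ₜ w) ⊗ₜ u) =
      q (TensorProduct.map (q ∘ₗ TensorProduct.mk k V V v) (q ∘ₗ TensorProduct.mk k V V w)
        (Coalgebra.comul (R := k) u))) :
    beta12 (binaryBraiding q) ∘ₗ beta23 (binaryBraiding q) ∘ₗ beta12 (binaryBraiding q) =
      beta23 (binaryBraiding q) ∘ₗ beta12 (binaryBraiding q) ∘ₗ beta23 (binaryBraiding q) := by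
  obtain ⟨S, hS⟩ := exists_comul_eq_sum k V
  have hb : ∀ v w : V, binaryBraiding q (v ⊗ₜ w) =
      ∑ p ∈ S w, p.1 ⊗ₜ[k] q (v ⊗ₜ p.2) := by
    intro v w
    simp [binaryBraiding, hS, TensorProduct.tmul_sum]
  have h12 : ∀ u v w : V, beta12 (binaryBraiding q) (u ⊗ₜ (v ⊗ₜ w)) =
      ∑ p ∈ S v, p.1 ⊗ₜ[k] (q (u ⊗ₜ p.2) ⊗ₜ[k] w) := by
    intro u v w
    simp [beta12, hb, TensorProduct.sum_tmul]
  have h23 : ∀ u v w : V, beta23 (binaryBraiding q) (u ⊗ₜ (v ⊗ₜ w)) =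
      ∑ p ∈ S w, u ⊗ₜ[k] (p.1 ⊗ₜ[k] q (v ⊗ₜ p.2)) := by
    intro u v w
    simp [beta23, hb, TensorProduct.tmul_sum]
  have hword : ∀ a b b' p r u : V, p ⊗ₜ[k] (q (b ⊗ₜ r) ⊗ₜ[k] q (q (a ⊗ₜ b') ⊗ₜ u)) =
      ∑ s ∈ S u, braidWord q a b b' ((p ⊗ₜ r) ⊗ₜ (s.1 ⊗ₜ s.2)) := by
    intro a b b' p r u
    rw [hsd, hS]
    simp [braidWord_tmul, TensorProduct.tmul_sum]
  have hq' : ∀ v w : V, Coalgebra.comul (R := k) (q (v ⊗ₜ w)) =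
      ∑ p ∈ S v, ∑ r ∈ S w, q (p.1 ⊗ₜ r.1) ⊗ₜ[k] q (p.2 ⊗ₜ r.2) := by
    intro v w
    rw [hq, TensorProduct.comul_tmul, hS, hS, Finset.sum_comm]
    simp [TensorProduct.sum_tmul, TensorProduct.tmul_sum]
  have h23' : ∀ u v b c : V, beta23 (binaryBraiding q) (u ⊗ₜ (v ⊗ₜ q (b ⊗ₜ c))) =
      ∑ p ∈ S b, ∑ r ∈ S c, u ⊗ₜ[k] (q (p.1 ⊗ₜ r.1) ⊗ₜ[k] q (v ⊗ₜ q (p.2 ⊗ₜ r.2))) := by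
    intro u v b c
    simp [beta23, binaryBraiding, hq', TensorProduct.tmul_sum]
  refine TensorProduct.ext_threefold' ?_
  intro a b c
  trans ∑ p ∈ S b, braidWord q a p.1 p.2
    (TensorProduct.map Coalgebra.comul Coalgebra.comul (Coalgebra.comul (R := k) c))
  · simp only [LinearMap.comp_apply, h12, h23, map_sum, hword]
    simp only [hS, map_sum, TensorProduct.map_tmul, TensorProduct.sum_tmul,
      TensorProduct.tmul_sum]
    exact Finset.sum_congr rfl fun _ _ => Finset.sum_congr rfl fun _ _ => Finset.sum_comm
  · rw [← tensorTensorTensorComm_map_comul_comul k c]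
    rw [LinearMap.comp_apply, LinearMap.comp_apply, h23]
    simp only [map_sum, h12, h23', ← braidWord_tmul]
    simp only [hS, map_sum, TensorProduct.map_tmul, TensorProduct.sum_tmul,
      TensorProduct.tmul_sum, TensorProduct.tensorTensorTensorComm_tmul]
    exact Finset.sum_comm.trans (Finset.sum_congr rfl fun _ _ =>
      (Finset.sum_congr rfl fun _ _ => Finset.sum_comm).trans Finset.sum_comm)

end SelfDistributive

section Doubling

variable {k X : Type*} [CommRing k] [AddCommGroup X] [Module k X] [Coalgebra k X]

theorem exists_rep2 (x : X) : ∃ (n : ℕ) (x1 x2 : Fin n → X), Rep2 k x x1 x2 := by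
  unfold Rep2
  induction Coalgebra.comul (R := k) x using TensorProduct.induction_on with
  | zero => exact ⟨0, 0, 0, by simp⟩
  | tmul a b => exact ⟨1, fun _ => a, fun _ => b, by simp⟩
  | add s t hs ht =>
    obtain ⟨n, a, b, rfl⟩ := hs
    obtain ⟨m, c, d, rfl⟩ := ht
    exact ⟨n + m, Fin.append a c, Fin.append b d, by simp [Fin.sum_univ_add]⟩

theorem exists_rep3 (x : X) : ∃ (n : ℕ) (x1 x2 x3 : Fin n → X), Rep3 k x x1 x2 x3 := by
  unfold Rep3
  have hadd : ∀ s t : X ⊗[k] (X ⊗[k] X),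
      (∃ (n : ℕ) (x1 x2 x3 : Fin n → X), s = ∑ i, x1 i ⊗ₜ[k] (x2 i ⊗ₜ[k] x3 i)) →
      (∃ (n : ℕ) (x1 x2 x3 : Fin n → X), t = ∑ i, x1 i ⊗ₜ[k] (x2 i ⊗ₜ[k] x3 i)) →
      ∃ (n : ℕ) (x1 x2 x3 : Fin n → X), s + t = ∑ i, x1 i ⊗ₜ[k] (x2 i ⊗ₜ[k] x3 i) := by
    rintro _ _ ⟨n, a, b, c, rfl⟩ ⟨m, a', b', c', rfl⟩
    exact ⟨n + m, Fin.append a a', Fin.append b b', Fin.append c c', by simp [Fin.sum_univ_add]⟩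
  induction delta3 k x using TensorProduct.induction_on with
  | zero => exact ⟨0, 0, 0, 0, by simp⟩
  | add s t hs ht => exact hadd s t hs ht
  | tmul a t =>
    induction t using TensorProduct.induction_on with
    | zero => exact ⟨0, 0, 0, 0, by simp⟩
    | add s t hs ht => rw [TensorProduct.tmul_add]; exact hadd _ _ hs ht
    | tmul b c => exact ⟨1, fun _ => a, fun _ => b, fun _ => c, by simp⟩

theorem delta3_tmul {y z : X} {n m : ℕ} {y1 y2 y3 : Fin n → X} {z1 z2 z3 : Fin m → X}
    (hy : Rep3 k y y1 y2 y3) (hz : Rep3 k z z1 z2 z3) :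
    delta3 k (y ⊗ₜ[k] z) = ∑ i, ∑ j, (y1 i ⊗ₜ[k] z1 j) ⊗ₜ[k]
      ((y2 i ⊗ₜ[k] z2 j) ⊗ₜ[k] (y3 i ⊗ₜ[k] z3 j)) := by
  obtain ⟨S, hS⟩ := exists_comul_eq_sum k X
  let H := LinearMap.lTensor (X ⊗[k] X)
      (TensorProduct.tensorTensorTensorComm k X X X X).toLinearMap ∘ₗ
    (TensorProduct.tensorTensorTensorComm k X (X ⊗[k] X) X (X ⊗[k] X)).toLinearMap
  have h : delta3 k (y ⊗ₜ[k] z) = H (delta3 k y ⊗ₜ delta3 k z) := by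
    simp [delta3, H, hS, TensorProduct.sum_tmul, TensorProduct.tmul_sum]
    exact Finset.sum_congr rfl fun _ _ => Finset.sum_comm
  rw [h, hy, hz]
  simp only [H, LinearMap.comp_apply, TensorProduct.sum_tmul, TensorProduct.tmul_sum, map_sum]
  simpa using Finset.sum_comm

/-- The map `(x ⊗ x') ⊗ w ↦ T(x ⊗ w⁽¹⁾) ⊗ T(x' ⊗ w⁽²⁾)`. -/
noncomputable def doubledOp (T : X ⊗[k] (X ⊗[k] X) →ₗ[k] X) :
    (X ⊗[k] X) ⊗[k] (X ⊗[k] X) →ₗ[k] X ⊗[k] X :=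
  TensorProduct.map T T ∘ₗ
    (TensorProduct.tensorTensorTensorComm k X X (X ⊗[k] X) (X ⊗[k] X)).toLinearMap ∘ₗ
      LinearMap.lTensor (X ⊗[k] X) Coalgebra.comul

theorem doubledOp_tmul (T : X ⊗[k] (X ⊗[k] X) →ₗ[k] X) (x x' : X) (w : X ⊗[k] X) :
    doubledOp T ((x ⊗ₜ x') ⊗ₜ w) =
      TensorProduct.map (T ∘ₗ TensorProduct.mk k _ _ x) (T ∘ₗ TensorProduct.mk k _ _ x')
        (Coalgebra.comul (R := k) w) := by
  obtain ⟨S, hS⟩ := exists_comul_eq_sum k (X ⊗[k] X)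
  simp [doubledOp, hS, TensorProduct.tmul_sum]

theorem IsCoalgMor.comul_apply {T : X ⊗[k] (X ⊗[k] X) →ₗ[k] X} (hT : IsCoalgMor k T)
    (v : X ⊗[k] (X ⊗[k] X)) :
    Coalgebra.comul (R := k) (T v) = TensorProduct.map T T (Coalgebra.comul (R := k) v) := by
  suffices h : Coalgebra.comul (R := k) ∘ₗ T = TensorProduct.map T T ∘ₗ Coalgebra.comul (R := k) from
    LinearMap.congr_fun h v
  refine TensorProduct.ext_threefold' ?_
  intro x y z
  obtain ⟨_, x1, x2, hx⟩ := exists_rep2 (k := k) x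
  obtain ⟨_, y1, y2, hy⟩ := exists_rep2 (k := k) y
  obtain ⟨_, z1, z2, hz⟩ := exists_rep2 (k := k) z
  rw [LinearMap.comp_apply, hT.2 x y z x1 x2 y1 y2 z1 z2 hx hy hz]
  unfold Rep2 at hx hy hz
  simp only [LinearMap.comp_apply, TensorProduct.comul_tmul, hx, hy, hz, TensorProduct.sum_tmul,
    TensorProduct.tmul_sum, map_sum]
  simp only [TensorProduct.AlgebraTensorModule.tensorTensorTensorComm_tmul, TensorProduct.map_tmul]
  exact (sum_comm_reverse _ _ _ _).symm

theorem IsTSD.apply_tmul {T : X ⊗[k] (X ⊗[k] X) →ₗ[k] X} (hT : IsTSD k T) (x : X)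
    (w u : X ⊗[k] X) :
    T (T (x ⊗ₜ w) ⊗ₜ u) =
      T (TensorProduct.map (T ∘ₗ TensorProduct.mk k _ _ x) (doubledOp T ∘ₗ TensorProduct.mk k _ _ w)
        (Coalgebra.comul (R := k) u)) := by
  induction w using TensorProduct.induction_on with
  | zero => simp
  | add s t hs ht =>
    simp only [TensorProduct.tmul_add, TensorProduct.add_tmul, map_add, hs, ht, LinearMap.comp_add,
      TensorProduct.map_add_right, LinearMap.add_apply]
  | tmul y z =>
    have h : ∀ u : X ⊗[k] X,
        TensorProduct.map (T ∘ₗ TensorProduct.mk k _ _ x)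
          (doubledOp T ∘ₗ TensorProduct.mk k _ _ (y ⊗ₜ z)) (Coalgebra.comul (R := k) u) =
        TensorProduct.map (T ∘ₗ TensorProduct.mk k _ _ x)
          (TensorProduct.map (T ∘ₗ TensorProduct.mk k _ _ y) (T ∘ₗ TensorProduct.mk k _ _ z))
          (delta3 k u) := by
      intro u
      obtain ⟨S, hS⟩ := exists_comul_eq_sum k (X ⊗[k] X)
      simp [delta3, hS, doubledOp_tmul]
    rw [h]
    induction u using TensorProduct.induction_on with
    | zero => simp
    | add s t hs ht => simp only [TensorProduct.tmul_add, map_add, hs, ht]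
    | tmul u v =>
      obtain ⟨_, u1, u2, u3, hu⟩ := exists_rep3 (k := k) u
      obtain ⟨_, v1, v2, v3, hv⟩ := exists_rep3 (k := k) v
      rw [hT x y z u v u1 u2 u3 v1 v2 v3 hu hv, delta3_tmul hu hv]
      simp

theorem comul_doubledOp [Coalgebra.IsCocomm k X] {T : X ⊗[k] (X ⊗[k] X) →ₗ[k] X}
    (hT : IsCoalgMor k T) (v : (X ⊗[k] X) ⊗[k] (X ⊗[k] X)) :
    Coalgebra.comul (R := k) (doubledOp T v) =
      TensorProduct.map (doubledOp T) (doubledOp T) (Coalgebra.comul (R := k) v) := by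
  suffices h : Coalgebra.comul (R := k) ∘ₗ doubledOp T =
      TensorProduct.map (doubledOp T) (doubledOp T) ∘ₗ Coalgebra.comul (R := k) from
    LinearMap.congr_fun h v
  obtain ⟨S, hS⟩ := exists_comul_eq_sum k X
  obtain ⟨R, hR⟩ := exists_comul_eq_sum k (X ⊗[k] X)
  refine TensorProduct.ext (TensorProduct.ext' fun x x' => LinearMap.ext fun w => ?_)
  let L : X → (X ⊗[k] X →ₗ[k] X) := fun a => T ∘ₗ TensorProduct.mk k _ _ a
  have hL : ∀ a u, T (a ⊗ₜ u) = L a u := fun _ _ => rfl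
  have hcL : ∀ (a : X) (u : X ⊗[k] X), Coalgebra.comul (R := k) (L a u) =
      ∑ p ∈ S a, TensorProduct.map (L p.1) (L p.2) (Coalgebra.comul (R := k) u) := by
    intro a u
    rw [← hL, hT.comul_apply, TensorProduct.comul_tmul, hS, hR]
    simp [hL, TensorProduct.sum_tmul, TensorProduct.tmul_sum]
    exact Finset.sum_comm
  have hq : ∀ (a b : X) (u : X ⊗[k] X), doubledOp T ((a ⊗ₜ b) ⊗ₜ u) =
      TensorProduct.map (L a) (L b) (Coalgebra.comul (R := k) u) := doubledOp_tmul T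
  trans ∑ p ∈ S x, ∑ r ∈ S x', TensorProduct.map (TensorProduct.map (L p.1) (L r.1))
    (TensorProduct.map (L p.2) (L r.2)) (TensorProduct.map Coalgebra.comul Coalgebra.comul
      (Coalgebra.comul (R := k) w))
  · rw [← tensorTensorTensorComm_map_comul_comul k w]
    simp [hq, hR w, hcL, TensorProduct.sum_tmul, TensorProduct.tmul_sum]
    simp [hR, TensorProduct.sum_tmul, TensorProduct.tmul_sum]
    exact sum_comm_reverse _ _ _ _
  · simp [hS, hR w, hq, TensorProduct.sum_tmul, TensorProduct.tmul_sum]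
    exact (sum_comm_reverse _ _ _ _).symm

theorem doubledOp_selfDistributive [Coalgebra.IsCocomm k X] {T : X ⊗[k] (X ⊗[k] X) →ₗ[k] X}
    (hTSD : IsTSD k T) (hT : IsCoalgMor k T) (v w u : X ⊗[k] X) :
    doubledOp T (doubledOp T (v ⊗ₜ w) ⊗ₜ u) =
      doubledOp T (TensorProduct.map (doubledOp T ∘ₗ TensorProduct.mk k _ _ v)
        (doubledOp T ∘ₗ TensorProduct.mk k _ _ w) (Coalgebra.comul (R := k) u)) := by
  obtain ⟨S, hS⟩ := exists_comul_eq_sum k (X ⊗[k] X)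
  induction v using TensorProduct.induction_on with
  | zero => simp
  | add s t hs ht =>
    simp only [TensorProduct.add_tmul, map_add, hs, ht, LinearMap.comp_add,
      TensorProduct.map_add_left, LinearMap.add_apply]
  | tmul x x' =>
    let F : X → X ⊗[k] X → ((X ⊗[k] X) ⊗[k] (X ⊗[k] X) →ₗ[k] X) := fun a p =>
      T ∘ₗ TensorProduct.map (T ∘ₗ TensorProduct.mk k _ _ a) (doubledOp T ∘ₗ TensorProduct.mk k _ _ p)
    have hF : ∀ a p s t, T (T (a ⊗ₜ s) ⊗ₜ doubledOp T (p ⊗ₜ t)) = F a p (s ⊗ₜ t) :=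
      fun _ _ _ _ => rfl
    have hT' : ∀ a p s, T (T (a ⊗ₜ p) ⊗ₜ s) = F a p (Coalgebra.comul (R := k) s) := hTSD.apply_tmul
    have hq : ∀ (a b : X) (u : X ⊗[k] X), doubledOp T ((a ⊗ₜ b) ⊗ₜ u) =
        ∑ p ∈ S u, T (a ⊗ₜ p.1) ⊗ₜ[k] T (b ⊗ₜ p.2) := by
      intro a b u
      rw [doubledOp_tmul, hS]
      simp
    have hcq : ∀ (a b : X) (p u : X ⊗[k] X), doubledOp T ((a ⊗ₜ b) ⊗ₜ doubledOp T (p ⊗ₜ u)) =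
        ∑ r ∈ S p, ∑ s ∈ S u,
          T (a ⊗ₜ doubledOp T (r.1 ⊗ₜ s.1)) ⊗ₜ[k] T (b ⊗ₜ doubledOp T (r.2 ⊗ₜ s.2)) := by
      intro a b p u
      rw [doubledOp_tmul, comul_doubledOp hT, TensorProduct.comul_tmul, hS, hS, Finset.sum_comm]
      simp [TensorProduct.sum_tmul, TensorProduct.tmul_sum]
    trans ∑ p ∈ S w, TensorProduct.map (F x p.1) (F x' p.2)
      (TensorProduct.map Coalgebra.comul Coalgebra.comul (Coalgebra.comul (R := k) u))
    · rw [hq x x' w, TensorProduct.sum_tmul, map_sum]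
      refine Finset.sum_congr rfl fun p _ => ?_
      simp only [hq, hT', hS u, map_sum, TensorProduct.map_tmul]
    · rw [← tensorTensorTensorComm_map_comul_comul k u]
      simp only [hS u, map_sum, TensorProduct.map_tmul, LinearMap.comp_apply,
        TensorProduct.mk_apply, hq x x', TensorProduct.sum_tmul, hcq, hF]
      simp only [hS, map_sum, TensorProduct.map_tmul, TensorProduct.sum_tmul,
        TensorProduct.tmul_sum, TensorProduct.tensorTensorTensorComm_tmul]
      exact Finset.sum_comm.trans (Finset.sum_congr rfl fun _ _ =>
        (Finset.sum_congr rfl fun _ _ => Finset.sum_comm).trans Finset.sum_comm)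

end Doubling

/-- the doubled braiding `β` induced by a TSD coalgebra morphism satisfies
the Yang–Baxter equation. -/
theorem doubled_braiding_YBE (k X : Type*) [CommRing k] [AddCommGroup X]
    [Module k X] [Coalgebra k X]
    (hcc : ∀ a : X, TensorProduct.comm k X X (Coalgebra.comul a) = Coalgebra.comul a)
    (T : X ⊗[k] (X ⊗[k] X) →ₗ[k] X)
    (hTSD : IsTSD k T) (hTmor : IsCoalgMor k T)
    (β : (X ⊗[k] X) ⊗[k] (X ⊗[k] X) →ₗ[k] (X ⊗[k] X) ⊗[k] (X ⊗[k] X))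
    (hβ : ∀ (x x' y z : X) {n m : ℕ} (y1 y2 y3 : Fin n → X) (z1 z2 z3 : Fin m → X),
      Rep3 k y y1 y2 y3 → Rep3 k z z1 z2 z3 →
      β ((x ⊗ₜ[k] x') ⊗ₜ[k] (y ⊗ₜ[k] z)) =
        ∑ i, ∑ j, (y1 i ⊗ₜ[k] z1 j) ⊗ₜ[k]
          (T (x ⊗ₜ[k] (y2 i ⊗ₜ[k] z2 j)) ⊗ₜ[k] T (x' ⊗ₜ[k] (y3 i ⊗ₜ[k] z3 j)))) :
    beta12 β ∘ₗ beta23 β ∘ₗ beta12 β = beta23 β ∘ₗ beta12 β ∘ₗ beta23 β := by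
  have : Coalgebra.IsCocomm k X := ⟨LinearMap.ext hcc⟩
  have hβq : β = binaryBraiding (doubledOp T) := by
    refine TensorProduct.ext_fourfold' ?_
    intro x x' y z
    obtain ⟨_, y1, y2, y3, hy⟩ := exists_rep3 (k := k) y
    obtain ⟨_, z1, z2, z3, hz⟩ := exists_rep3 (k := k) z
    have h : ∀ u : X ⊗[k] X, binaryBraiding (doubledOp T) ((x ⊗ₜ x') ⊗ₜ u) =
        LinearMap.lTensor (X ⊗[k] X) (TensorProduct.map (T ∘ₗ TensorProduct.mk k _ _ x)
          (T ∘ₗ TensorProduct.mk k _ _ x')) (delta3 k u) := by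
      intro u
      obtain ⟨S, hS⟩ := exists_comul_eq_sum k (X ⊗[k] X)
      simp [binaryBraiding, delta3, hS, doubledOp_tmul, TensorProduct.tmul_sum]
    rw [hβ x x' y z y1 y2 y3 z1 z2 z3 hy hz, h, delta3_tmul hy hz]
    simp
  rw [hβq]
  exact binaryBraiding_YBE _ (comul_doubledOp hTmor) (doubledOp_selfDistributive hTSD hTmor)
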